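/- Let G = LΓ ⋊ V be a twisted fraction group associated to (Γ, α₀, α₁) with α₀, α₁ automorphisms. Then the subgroup L(Γ^α) ⋊ V is contained in the derived subgroup [G,G], where Γ^α = {g ∈ Γ : g = α₀(g) = α₁(g)}. In particular, when α₀ = α₁ = id_Γ, the group G is perfect... no: G' contains LΓ ⋊ V, hence every morphism from G to an abelian group kills L(Γ^α) ⋊ V. -/

import Mathlib

/-! Basic setup: the Cantor space, prefix replacement, Thompson's group `V`,
slopes, dyadic rationals, standard dyadic partitions, locally constant maps,
and the permutation model of the twisted fraction groups `LΓ ⋊ V`. -/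

abbrev Cantor : Type := ℕ → Bool

/-- Concatenation of a finite word with an infinite sequence. -/
def cat (w : List Bool) (x : Cantor) : Cantor :=
  fun n => if n < w.length then w.getD n false else x (n - w.length)

/-- The standard dyadic interval (cylinder) associated to a finite word. -/
def cyl (w : List Bool) : Set Cantor := {x | ∃ y : Cantor, x = cat w y}

/-- Membership in Thompson's group `V`: a homeomorphism of the Cantor space which is
everywhere locally given by prefix replacement. -/
def memV (v : Cantor ≃ₜ Cantor) : Prop :=
  ∀ x : Cantor, ∃ (m w : List Bool) (y : Cantor),
    x = cat m y ∧ ∀ z : Cantor, v (cat m z) = cat w z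

/-- `HasLogSlope v x k` : `k = log₂ v'(x)`, base-2 logarithm of the slope of `v` at `x`. -/
def HasLogSlope (v : Cantor ≃ₜ Cantor) (x : Cantor) (k : ℤ) : Prop :=
  ∃ (m w : List Bool) (y : Cantor),
    x = cat m y ∧ (∀ z : Cantor, v (cat m z) = cat w z) ∧
      k = (m.length : ℤ) - (w.length : ℤ)

open Classical in
noncomputable def logSlope (v : Cantor ≃ₜ Cantor) (x : Cantor) : ℤ :=
  if h : ∃ k : ℤ, HasLogSlope v x k then h.choose else 0

/-- The eventually periodic sequence `c∞ = c·c·c⋯`. -/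
def tailSeq (c : List Bool) : Cantor := fun n => c.getD (n % c.length) false

/-- `x` lies in the tail equivalence class of the word `c`, i.e. `x = y·c∞`. -/
def InTailClass (x : Cantor) (c : List Bool) : Prop :=
  ∃ y : List Bool, x = cat y (tailSeq c)

/-- `x` is eventually periodic (a rational point of the Cantor space). -/
def EvPeriodic (x : Cantor) : Prop :=
  ∃ (y c : List Bool), c ≠ [] ∧ x = cat y (tailSeq c)

/-- A prime word: a nonempty word which is not a proper power of a word. -/
def PrimeWord (c : List Bool) : Prop :=
  c ≠ [] ∧ ∀ (d : List Bool) (k : ℕ), 2 ≤ k → c ≠ (List.replicate k d).flatten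

/-- `conjH φ v = φ ∘ v ∘ φ⁻¹`. -/
def conjH (φ v : Cantor ≃ₜ Cantor) : Cantor ≃ₜ Cantor := φ.symm.trans (v.trans φ)

/-- `φ` normalizes Thompson's group `V` inside `Homeo(𝔠)` : `φ V φ⁻¹ = V`. -/
def NormalizesV (φ : Cantor ≃ₜ Cantor) : Prop :=
  (conjH φ) '' {v | memV v} = {v | memV v}

/-- The copy of the dyadic rationals `Q₂ ⊂ 𝔠` : finitely supported sequences. -/
def InQ2 (x : Cantor) : Prop := ∃ n : ℕ, ∀ m, n ≤ m → x m = false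

def zeroSeq : Cantor := fun _ => false

/-- A standard dyadic partition of the Cantor space. -/
def IsSDP (P : Finset (List Bool)) : Prop :=
  ∀ x : Cantor, ∃! w : List Bool, w ∈ P ∧ x ∈ cyl w

/-- Locally constant map: constant on each piece of some standard dyadic partition. -/
def IsLC {Γ : Type*} (f : Cantor → Γ) : Prop :=
  ∃ P : Finset (List Bool), IsSDP P ∧ ∀ w ∈ P, ∀ y z : Cantor, f (cat w y) = f (cat w z)

/-- `h` agrees on `Q₂` with (the restriction of) a locally constant map. -/
def AgreesOnQ2WithLC {Γ : Type*} (h : Cantor → Γ) : Prop :=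
  ∃ b : Cantor → Γ, IsLC b ∧ ∀ x, InQ2 x → h x = b x

section GroupPart
variable {Γ : Type*} [Group Γ]

/-- `alphaWord α₀ α₁ (m₁⋯m_k) = α_{m_k} ∘ ⋯ ∘ α_{m₁}`. -/
def alphaWord (α₀ α₁ : Γ ≃* Γ) (m : List Bool) : Γ ≃* Γ :=
  m.foldl (fun acc b => acc.trans (if b then α₁ else α₀)) (MulEquiv.refl Γ)

open Classical in
/-- The twisting automorphism `τ_{v,x} = α_{v(I)}⁻¹ ∘ α_I` for a standard dyadic
interval `I` containing `x` and adapted to `v`. -/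
noncomputable def tauEquiv (α₀ α₁ : Γ ≃* Γ) (v : Cantor ≃ₜ Cantor) (x : Cantor) : Γ ≃* Γ :=
  if h : ∃ p : List Bool × List Bool, x ∈ cyl p.1 ∧ ∀ z : Cantor, v (cat p.1 z) = cat p.2 z
  then (alphaWord α₀ α₁ h.choose.1).trans (alphaWord α₀ α₁ h.choose.2).symm
  else MulEquiv.refl Γ

/-- The element `a·v` of the twisted `LΓ ⋊ V`, realized as the permutation
`(x,g) ↦ (v x, a(v x) · τ_{v,x}(g))` of `𝔠 × Γ`. -/
noncomputable def permOf (α₀ α₁ : Γ ≃* Γ) (a : Cantor → Γ) (v : Cantor ≃ₜ Cantor) :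
    Equiv.Perm (Cantor × Γ) where
  toFun p := (v p.1, a (v p.1) * tauEquiv α₀ α₁ v p.1 p.2)
  invFun p := (v.symm p.1, (tauEquiv α₀ α₁ v (v.symm p.1)).symm ((a p.1)⁻¹ * p.2))
  left_inv := by rintro ⟨x, g⟩; simp
  right_inv := by rintro ⟨x, g⟩; simp

end GroupPart

/-- The twisted fraction group `G = LΓ ⋊ V` of the triple `(Γ, α₀, α₁)`,
as a group of permutations of `𝔠 × Γ`. -/
noncomputable def Gsub (Γ : Type*) [Group Γ] (α₀ α₁ : Γ ≃* Γ) :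
    Subgroup (Equiv.Perm (Cantor × Γ)) :=
  Subgroup.closure {p | ∃ a v, IsLC a ∧ memV v ∧ p = permOf α₀ α₁ a v}

/-- The untwisted case `α₀ = α₁ = id`. -/
noncomputable def permOfU {Γ : Type*} [Group Γ] (a : Cantor → Γ) (v : Cantor ≃ₜ Cantor) :=
  permOf (MulEquiv.refl Γ) (MulEquiv.refl Γ) a v

/-- The untwisted fraction group `G = LΓ ⋊ V`. -/
noncomputable def GsubU (Γ : Type*) [Group Γ] := Gsub Γ (MulEquiv.refl Γ) (MulEquiv.refl Γ)

/-- `f ∈ N_{K̄}(G)` : the element `f` of `K̄ = ∏_{Q₂}Γ` normalizes `G = LΓ ⋊ V`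
(untwisted case), i.e. `f·a·(f^v)⁻¹` and `f⁻¹·a·f^v` are locally constant on `Q₂`. -/
def InNormKbar {Γ : Type*} [Group Γ] (f : Cantor → Γ) : Prop :=
  ∀ (a : Cantor → Γ) (v : Cantor ≃ₜ Cantor), IsLC a → memV v →
    AgreesOnQ2WithLC (fun x => f x * a x * (f (v.symm x))⁻¹) ∧
    AgreesOnQ2WithLC (fun x => (f x)⁻¹ * a x * f (v.symm x))

namespace TV

def tl (n : ℕ) (x : Cantor) : Cantor := fun k => x (k + n)

def pre (n : ℕ) (x : Cantor) : List Bool := List.ofFn (fun i : Fin n => x i)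

lemma pre_length (n : ℕ) (x : Cantor) : (pre n x).length = n := by simp [pre]

lemma cat_nil (y : Cantor) : cat [] y = y := by funext n; simp [cat]

lemma cat_append (a b : List Bool) (y : Cantor) : cat (a ++ b) y = cat a (cat b y) := by
  funext n
  simp only [cat, List.length_append]
  by_cases h1 : n < a.length
  · have : n < a.length + b.length := by omega
    simp only [h1, this, if_true]
    rw [List.getD_append _ _ _ _ h1]
  · by_cases h2 : n < a.length + b.length
    · have h3 : n - a.length < b.length := by omega
      simp only [h1, h2, h3, if_true, if_false]
      rw [List.getD_append_right _ _ _ _ (by omega)]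
    · have h3 : ¬ n - a.length < b.length := by omega
      simp only [h1, h2, h3, if_false]
      congr 1; omega

lemma tl_cat (w : List Bool) (y : Cantor) : tl w.length (cat w y) = y := by
  funext k; simp [tl, cat]

lemma cat_inj {w : List Bool} {y z : Cantor} (h : cat w y = cat w z) : y = z := by
  rw [← tl_cat w y, h, tl_cat]

lemma cat_lt (w : List Bool) (y : Cantor) {i : ℕ} (h : i < w.length) :
    cat w y i = w.getD i false := by simp [cat, h]

lemma mem_cyl_iff {w : List Bool} {x : Cantor} :
    x ∈ cyl w ↔ ∀ i < w.length, x i = w.getD i false := by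
  constructor
  · rintro ⟨y, rfl⟩ i hi
    exact cat_lt w y hi
  · intro h
    refine ⟨tl w.length x, ?_⟩
    funext n
    by_cases hn : n < w.length
    · rw [cat_lt _ _ hn, h n hn]
    · simp only [cat, hn, if_false, tl]
      congr 1; omega

lemma cat_mem (w : List Bool) (y : Cantor) : cat w y ∈ cyl w := ⟨y, rfl⟩

lemma pre_getD (n : ℕ) (x : Cantor) {i : ℕ} (h : i < n) : (pre n x).getD i false = x i := by
  have : i < (pre n x).length := by rw [pre_length]; exact h
  rw [List.getD_eq_getElem _ _ this]
  simp [pre]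

lemma mem_cyl_pre (n : ℕ) (x : Cantor) : x ∈ cyl (pre n x) := by
  rw [mem_cyl_iff]
  intro i hi
  rw [pre_length] at hi
  rw [pre_getD n x hi]

lemma eq_pre {w : List Bool} {x : Cantor} (h : x ∈ cyl w) : w = pre w.length x := by
  rw [mem_cyl_iff] at h
  apply List.ext_getElem
  · rw [pre_length]
  · intro i h1 h2
    have := h i h1
    rw [List.getD_eq_getElem _ _ h1] at this
    simp [pre, this]

lemma exists_append {p q : List Bool} {x : Cantor} (hp : x ∈ cyl p) (hq : x ∈ cyl q)
    (h : q.length ≤ p.length) : ∃ e, p = q ++ e := by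
  refine ⟨p.drop q.length, ?_⟩
  have : p.take q.length = q := by
    apply List.ext_getElem
    · simp [h]
    · intro i h1 h2
      rw [mem_cyl_iff] at hp hq
      have a1 := hp i (by omega)
      have a2 := hq i h2
      rw [List.getD_eq_getElem _ _ (by omega)] at a1 a2
      simp [← a1, ← a2]
  conv_lhs => rw [← List.take_append_drop q.length p, this]

lemma isOpen_cyl (w : List Bool) : IsOpen (cyl w) := by
  have : cyl w = ⋂ i ∈ Finset.range w.length, {x : Cantor | x i = w.getD i false} := by
    ext x; simp [mem_cyl_iff]
  rw [this]
  apply isOpen_biInter_finset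
  intro i _
  have hc : Continuous (fun x : Cantor => x i) := continuous_apply i
  exact (isOpen_discrete ({w.getD i false} : Set Bool)).preimage hc

lemma cyl_univ {p : List Bool} (h : ∀ x, x ∈ cyl p) : p = [] := by
  cases p with
  | nil => rfl
  | cons b p =>
    have := (mem_cyl_iff.1 (h (fun _ => !b))) 0 (by simp)
    simp at this

lemma continuous_cat (w : List Bool) : Continuous (cat w) := by
  apply continuous_pi
  intro n
  by_cases h : n < w.length
  · simp only [cat, h, if_true]; exact continuous_const
  · simp only [cat, h, if_false]; exact continuous_apply _

lemma continuous_tl (n : ℕ) : Continuous (tl n) := by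
  apply continuous_pi
  intro k
  exact continuous_apply _

/-- Locally prefix replacing functions. -/
def LP (f : Cantor → Cantor) : Prop :=
  ∀ x : Cantor, ∃ (m w : List Bool), x ∈ cyl m ∧ ∀ z : Cantor, f (cat m z) = cat w z

lemma LP.continuous {f : Cantor → Cantor} (h : LP f) : Continuous f := by
  rw [continuous_iff_continuousAt]
  intro x
  obtain ⟨m, w, hx, hf⟩ := h x
  have h1 : ContinuousAt (fun y => cat w (tl m.length y)) x :=
    ((continuous_cat w).comp (continuous_tl _)).continuousAt
  refine h1.congr ?_
  filter_upwards [(isOpen_cyl m).mem_nhds hx] with y hy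
  obtain ⟨z, rfl⟩ := hy
  rw [hf, tl_cat]

lemma memV_iff {v : Cantor ≃ₜ Cantor} : memV v ↔ LP v := by
  constructor
  · intro h x
    obtain ⟨m, w, y, hx, hf⟩ := h x
    exact ⟨m, w, ⟨y, hx⟩, hf⟩
  · intro h x
    obtain ⟨m, w, ⟨y, hx⟩, hf⟩ := h x
    exact ⟨m, w, y, hx, hf⟩

/-- Common refinement for compositions. -/
lemma LP.comp_aux {f g : Cantor → Cantor} (hf : LP f) (hg : LP g) (x : Cantor) :
    ∃ m w w', x ∈ cyl m ∧ (∀ z, g (cat m z) = cat w z) ∧ (∀ z, f (cat w z) = cat w' z) := by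
  obtain ⟨m, w, ⟨y, hx⟩, h1⟩ := hg x
  obtain ⟨p, q, hp, h2⟩ := hf (g x)
  obtain ⟨t, ht⟩ := mem_cyl_pre p.length y
  have hx' : x = cat (m ++ pre p.length y) t := by rw [cat_append, ← ht, hx]
  have hgx : g x ∈ cyl (w ++ pre p.length y) := ⟨t, by rw [hx, h1, cat_append, ← ht]⟩
  obtain ⟨e, he⟩ := exists_append hgx hp (by rw [List.length_append, pre_length]; omega)
  refine ⟨m ++ pre p.length y, w ++ pre p.length y, q ++ e, ⟨t, hx'⟩, ?_, ?_⟩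
  · intro z; rw [cat_append, h1, cat_append]
  · intro z; rw [he, cat_append, h2, cat_append]

lemma LP.symm {v : Cantor ≃ Cantor} (h : LP v) : LP v.symm := by
  intro x
  obtain ⟨m, w, ⟨y, hx⟩, hf⟩ := h (v.symm x)
  refine ⟨w, m, ⟨y, ?_⟩, ?_⟩
  · rw [← hf, ← hx]; simp
  · intro z; rw [← hf]; simp

def Vsub : Subgroup (Cantor ≃ₜ Cantor) where
  carrier := {v | memV v}
  one_mem' := memV_iff.2 (fun x => ⟨[], [], ⟨x, (cat_nil x).symm⟩, fun z => rfl⟩)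
  mul_mem' := by
    intro a b ha hb
    refine memV_iff.2 (fun x => ?_)
    obtain ⟨m, w, w', hx, h1, h2⟩ := LP.comp_aux (memV_iff.1 ha) (memV_iff.1 hb) x
    exact ⟨m, w', hx, fun z => by
      rw [Homeomorph.mul_apply, h1, h2]⟩
  inv_mem' := by
    intro a ha
    exact memV_iff.2 (LP.symm (v := a.toEquiv) (memV_iff.1 ha))

def Dj (a b : List Bool) : Prop := ∀ x, x ∈ cyl a → x ∈ cyl b → False

lemma Dj.symm {a b : List Bool} (h : Dj a b) : Dj b a := fun x h1 h2 => h x h2 h1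

open Classical in
noncomputable def swFun (a b : List Bool) (x : Cantor) : Cantor :=
  if x ∈ cyl a then cat b (tl a.length x) else if x ∈ cyl b then cat a (tl b.length x) else x

lemma swFun_left (a b : List Bool) (z : Cantor) : swFun a b (cat a z) = cat b z := by
  simp [swFun, cat_mem, tl_cat]

lemma swFun_right {a b : List Bool} (h : Dj a b) (z : Cantor) :
    swFun a b (cat b z) = cat a z := by
  have : cat b z ∉ cyl a := fun h' => h _ h' (cat_mem b z)
  simp [swFun, cat_mem, tl_cat, this]

lemma swFun_other {a b : List Bool} {x : Cantor} (h1 : x ∉ cyl a) (h2 : x ∉ cyl b) :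
    swFun a b x = x := by simp [swFun, h1, h2]

lemma swFun_invol {a b : List Bool} (h : Dj a b) (x : Cantor) :
    swFun a b (swFun a b x) = x := by
  by_cases h1 : x ∈ cyl a
  · obtain ⟨z, rfl⟩ := h1
    rw [swFun_left, swFun_right h]
  · by_cases h2 : x ∈ cyl b
    · obtain ⟨z, rfl⟩ := h2
      rw [swFun_right h, swFun_left]
    · rw [swFun_other h1 h2, swFun_other h1 h2]

lemma pre_notMem {a : List Bool} {x : Cantor} (h : x ∉ cyl a) {n : ℕ} (hn : a.length ≤ n)
    (z : Cantor) : cat (pre n x) z ∉ cyl a := by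
  intro h'
  apply h
  rw [mem_cyl_iff] at h' ⊢
  intro i hi
  rw [← h' i hi, cat_lt _ _ (by rw [pre_length]; omega), pre_getD _ _ (by omega)]

lemma swFun_LP {a b : List Bool} (h : Dj a b) : LP (swFun a b) := by
  intro x
  by_cases h1 : x ∈ cyl a
  · exact ⟨a, b, h1, swFun_left a b⟩
  · by_cases h2 : x ∈ cyl b
    · exact ⟨b, a, h2, swFun_right h⟩
    · refine ⟨pre (a.length + b.length) x, pre (a.length + b.length) x, mem_cyl_pre _ _, fun z => ?_⟩
      exact swFun_other (pre_notMem h1 (by omega) z) (pre_notMem h2 (by omega) z)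

noncomputable def sw (a b : List Bool) (h : Dj a b) : Vsub :=
  ⟨{ toFun := swFun a b
     invFun := swFun a b
     left_inv := swFun_invol h
     right_inv := swFun_invol h
     continuous_toFun := (swFun_LP h).continuous
     continuous_invFun := (swFun_LP h).continuous }, memV_iff.2 (swFun_LP h)⟩

lemma sw_apply {a b : List Bool} (h : Dj a b) (x : Cantor) : (sw a b h).1 x = swFun a b x := rfl

lemma sw_left {a b : List Bool} (h : Dj a b) (z : Cantor) :
    (sw a b h).1 (cat a z) = cat b z := swFun_left a b z
lemma sw_right {a b : List Bool} (h : Dj a b) (z : Cantor) :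
    (sw a b h).1 (cat b z) = cat a z := swFun_right h z
lemma sw_other {a b : List Bool} (h : Dj a b) {x : Cantor} (h1 : x ∉ cyl a) (h2 : x ∉ cyl b) :
    (sw a b h).1 x = x := swFun_other h1 h2

lemma sw_symm {a b : List Bool} (h : Dj a b) : sw a b h = sw b a h.symm := by
  apply Subtype.ext
  ext1 x
  by_cases h1 : x ∈ cyl a
  · obtain ⟨z, rfl⟩ := h1
    rw [sw_left, sw_right]
  · by_cases h2 : x ∈ cyl b
    · obtain ⟨z, rfl⟩ := h2
      rw [sw_left, sw_right]
    · rw [sw_other _ h1 h2, sw_other _ h2 h1]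

lemma sw_conj {a b c : List Bool} (hab : Dj a b) (hac : Dj a c) (hbc : Dj b c) :
    sw b c hbc * sw a b hab = sw a c hac * sw b c hbc := by
  apply Subtype.ext
  ext1 x
  simp only [Subgroup.coe_mul, Homeomorph.mul_apply]
  by_cases h1 : x ∈ cyl a
  · have h2 : x ∉ cyl b := fun h => hab _ h1 h
    have h3 : x ∉ cyl c := fun h => hac _ h1 h
    rw [sw_other hbc h2 h3]
    obtain ⟨z, rfl⟩ := h1
    rw [sw_left, sw_left, sw_left]
  · by_cases h2 : x ∈ cyl b
    · obtain ⟨z, rfl⟩ := h2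
      rw [sw_right, sw_left, sw_right, sw_other]
      · exact fun h => hab _ (cat_mem _ _) h
      · exact fun h => hac _ (cat_mem _ _) h
    · rw [sw_other hab h1 h2]
      by_cases h3 : x ∈ cyl c
      · obtain ⟨z, rfl⟩ := h3
        rw [sw_right, sw_other]
        · exact fun h => hab _ h (cat_mem _ _)
        · exact fun h => hbc _ (cat_mem _ _) h
      · rw [sw_other hbc h2 h3, sw_other hac h1 h3]

lemma cyl_append_sub {a e : List Bool} {x : Cantor} (h : x ∈ cyl (a ++ e)) : x ∈ cyl a := by
  obtain ⟨z, rfl⟩ := h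
  exact ⟨cat e z, cat_append _ _ _⟩

lemma Dj.app {a b : List Bool} (h : Dj a b) (e f : List Bool) : Dj (a ++ e) (b ++ f) :=
  fun x h1 h2 => h x (cyl_append_sub h1) (cyl_append_sub h2)

lemma Dj.appl {a b : List Bool} (h : Dj a b) (e : List Bool) : Dj (a ++ e) b :=
  fun x h1 h2 => h x (cyl_append_sub h1) h2

lemma Dj_sib (a : List Bool) : Dj (a ++ [false]) (a ++ [true]) := by
  rintro x ⟨y, rfl⟩ ⟨z, h⟩
  rw [cat_append, cat_append] at h
  have := congrFun (cat_inj h) 0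
  simp [cat] at this

lemma cat_split (a : List Bool) (z : Cantor) :
    ∃ y, cat a z = cat (a ++ [z 0]) y := by
  refine ⟨tl 1 z, ?_⟩
  rw [cat_append]
  congr 1
  funext n
  cases n <;> simp [cat, tl]

lemma mem_split {a : List Bool} {x : Cantor} (h : x ∈ cyl a) :
    x ∈ cyl (a ++ [false]) ∨ x ∈ cyl (a ++ [true]) := by
  obtain ⟨z, rfl⟩ := h
  obtain ⟨y, hy⟩ := cat_split a z
  cases hz : z 0
  · rw [hz] at hy; exact Or.inl ⟨y, hy⟩
  · rw [hz] at hy; exact Or.inr ⟨y, hy⟩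

lemma sw_split {a b : List Bool} (h : Dj a b) :
    sw a b h = sw (a ++ [false]) (b ++ [false]) (h.app _ _) *
      sw (a ++ [true]) (b ++ [true]) (h.app _ _) := by
  apply Subtype.ext
  ext1 x
  simp only [Subgroup.coe_mul, Homeomorph.mul_apply]
  by_cases h1 : x ∈ cyl a
  · have h2 : x ∉ cyl b := fun h' => h _ h1 h'
    rcases mem_split h1 with ⟨y, rfl⟩ | ⟨y, rfl⟩
    · rw [sw_other (h.app [true] [true]), sw_left, cat_append, cat_append, sw_left]
      · exact fun h' => Dj_sib a _ (cat_mem _ _) h'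
      · exact fun h' => h2 (cyl_append_sub h')
    · rw [sw_left, sw_other (h.app [false] [false]), cat_append, cat_append, sw_left]
      · exact fun h' => h _ (cyl_append_sub h') (cyl_append_sub (cat_mem _ _))
      · exact fun h' => Dj_sib b _ h' (cat_mem _ _)
  · by_cases h2 : x ∈ cyl b
    · rcases mem_split h2 with ⟨y, rfl⟩ | ⟨y, rfl⟩
      · rw [sw_other (h.app [true] [true]), sw_right, cat_append, cat_append, sw_right]
        · exact fun h' => h1 (cyl_append_sub h')
        · exact fun h' => Dj_sib b _ (cat_mem _ _) h'
      · rw [sw_right, sw_other (h.app [false] [false]), cat_append, cat_append, sw_right]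
        · exact fun h' => Dj_sib a _ h' (cat_mem _ _)
        · exact fun h' => h _ (cyl_append_sub (cat_mem _ _)) (cyl_append_sub h')
    · have k1 : ∀ e, x ∉ cyl (a ++ e) := fun e h' => h1 (cyl_append_sub h')
      have k2 : ∀ e, x ∉ cyl (b ++ e) := fun e h' => h2 (cyl_append_sub h')
      rw [sw_other h h1 h2, sw_other _ (k1 _) (k2 _), sw_other _ (k1 _) (k2 _)]

section perf
variable {A : Type*} [CommGroup A] (F : Vsub →* A)

lemma F_move {a b c : List Bool} (hab : Dj a b) (hac : Dj a c) (hbc : Dj b c) :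
    F (sw a b hab) = F (sw a c hac) := by
  have := congrArg F (sw_conj hab hac hbc)
  rw [map_mul, map_mul, mul_comm] at this
  exact mul_right_cancel this

lemma F_sw3 {a b c : List Bool} (hab : Dj a b) (hac : Dj a c) (hbc : Dj b c) :
    F (sw a b hab) = 1 := by
  have key : ∀ e f, F (sw (a ++ e) (b ++ f) (hab.app _ _)) = F (sw a b hab) := by
    intro e f
    rw [F_move F (hab.app e f) (hac.appl e) (hbc.appl f), sw_symm,
      F_move F (hac.appl e).symm hbc.symm (hab.appl e), sw_symm hbc.symm,
      sw_symm hab, F_move F hab.symm hbc hac]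
  have := congrArg F (sw_split hab)
  rw [map_mul, key, key] at this
  exact left_eq_mul.1 this

lemma F_sw {a b : List Bool} (hab : Dj a b) : F (sw a b hab) = 1 := by
  rw [sw_split, map_mul,
    F_sw3 F (hab.app _ _) (Dj_sib a) ((hab.app [true] [false]).symm),
    F_sw3 F (hab.app _ _) (Dj_sib a).symm ((hab.app [false] [true]).symm), one_mul]

end perf

lemma sdp_dj {P : Finset (List Bool)} (hP : IsSDP P) {a b : List Bool} (ha : a ∈ P) (hb : b ∈ P)
    (hab : a ≠ b) : Dj a b := fun x h1 h2 => hab ((hP x).unique ⟨ha, h1⟩ ⟨hb, h2⟩)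

lemma sib {P : Finset (List Bool)} (hP : IsSDP P) :
    [] ∈ P ∨ ∃ u, u ++ [false] ∈ P ∧ u ++ [true] ∈ P := by
  obtain ⟨p0, ⟨hp0, _⟩, _⟩ := hP zeroSeq
  obtain ⟨m, hm, hmax⟩ := P.exists_max_image List.length ⟨p0, hp0⟩
  rcases List.eq_nil_or_concat m with rfl | ⟨u, b, rfl⟩
  · exact Or.inl hm
  · right
    refine ⟨u, ?_⟩
    have hother : u ++ [!b] ∈ P := by
      obtain ⟨p, ⟨hp, hx⟩, _⟩ := hP (cat (u ++ [!b]) zeroSeq)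
      have hlen := hmax p hp
      obtain ⟨e, he⟩ := exists_append (cat_mem (u ++ [!b]) zeroSeq) hx (by simpa using hlen)
      rcases List.eq_nil_or_concat e with rfl | ⟨e', c, rfl⟩
      · rw [he]; simpa using hp
      · exfalso
        simp only [List.concat_eq_append] at he hm
        rw [← List.append_assoc] at he
        have hu : u = p ++ e' := (List.append_inj' he rfl).1
        have : p ≠ u ++ [b] := by
          intro h
          have := congrArg List.length hu
          rw [h] at this
          simp at this
        refine sdp_dj hP hp hm this (cat (u ++ [b]) zeroSeq) ?_ (cat_mem _ _)
        rw [hu, List.append_assoc]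
        exact cyl_append_sub (cat_mem _ _)
    simp only [List.concat_eq_append] at hm
    cases b
    · exact ⟨hm, hother⟩
    · exact ⟨hother, hm⟩

lemma sdp_image {P : Finset (List Bool)} (hP : IsSDP P) {w : List Bool → List Bool}
    {v : Cantor ≃ₜ Cantor} (hv : ∀ m ∈ P, ∀ z, v (cat m z) = cat (w m) z) :
    IsSDP (P.image w) := by
  intro x
  obtain ⟨m, ⟨hm, ⟨y, hy⟩⟩, hu⟩ := hP (v.symm x)
  refine ⟨w m, ⟨Finset.mem_image_of_mem w hm, ⟨y, ?_⟩⟩, ?_⟩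
  · rw [← hv m hm, ← hy]; simp
  · rintro q ⟨hq, ⟨z, hz⟩⟩
    obtain ⟨m', hm', rfl⟩ := Finset.mem_image.1 hq
    rw [hu m' ⟨hm', ⟨z, ?_⟩⟩]
    rw [hz, ← hv m' hm']; simp

lemma sdp_merge {P : Finset (List Bool)} (hP : IsSDP P) {u : List Bool}
    (h0 : u ++ [false] ∈ P) (h1 : u ++ [true] ∈ P) :
    IsSDP (insert u ((P.erase (u ++ [false])).erase (u ++ [true]))) := by
  intro x
  by_cases hx : x ∈ cyl u
  · refine ⟨u, ⟨Finset.mem_insert_self _ _, hx⟩, ?_⟩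
    rintro q ⟨hq, hxq⟩
    rcases Finset.mem_insert.1 hq with rfl | hq
    · rfl
    · exfalso
      simp only [Finset.mem_erase] at hq
      rcases mem_split hx with h | h
      · exact hq.2.1 ((hP x).unique ⟨hq.2.2, hxq⟩ ⟨h0, h⟩)
      · exact hq.1 ((hP x).unique ⟨hq.2.2, hxq⟩ ⟨h1, h⟩)
  · obtain ⟨m, ⟨hm, hxm⟩, hu⟩ := hP x
    refine ⟨m, ⟨?_, hxm⟩, ?_⟩
    · refine Finset.mem_insert_of_mem ?_
      simp only [Finset.mem_erase]
      refine ⟨?_, ?_, hm⟩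
      · rintro rfl; exact hx (cyl_append_sub hxm)
      · rintro rfl; exact hx (cyl_append_sub hxm)
    · rintro q ⟨hq, hxq⟩
      rcases Finset.mem_insert.1 hq with rfl | hq
      · exact absurd hxq hx
      · simp only [Finset.mem_erase] at hq
        exact hu q ⟨hq.2.2, hxq⟩

lemma card_merge {P : Finset (List Bool)} {u : List Bool}
    (h0 : u ++ [false] ∈ P) (h1 : u ++ [true] ∈ P) :
    (insert u ((P.erase (u ++ [false])).erase (u ++ [true]))).card < P.card := by
  have e1 : u ++ [true] ∈ P.erase (u ++ [false]) := by
    simp [Finset.mem_erase, h1]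
  have c1 := Finset.card_erase_add_one e1
  have c2 := Finset.card_erase_add_one h0
  have := Finset.card_insert_le u ((P.erase (u ++ [false])).erase (u ++ [true]))
  omega

section perf2
variable {A : Type*} [CommGroup A] (F : Vsub →* A)

def Tab (P : Finset (List Bool)) (w : List Bool → List Bool) (v : Vsub) : Prop :=
  ∀ m ∈ P, ∀ z, v.1 (cat m z) = cat (w m) z

lemma tab_swap {P : Finset (List Bool)} (hP : IsSDP P) {w : List Bool → List Bool} {v : Vsub}
    (hv : Tab P w v) {a b : List Bool} (ha : a ∈ P) (hb : b ∈ P) :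
    ∃ v', F v' = F v ∧ Tab P (fun m => w (Equiv.swap a b m)) v' := by
  by_cases hab : a = b
  · subst hab
    exact ⟨v, rfl, by simpa using hv⟩
  · have hd := sdp_dj hP ha hb hab
    refine ⟨v * sw a b hd, by rw [map_mul, F_sw, mul_one], ?_⟩
    intro m hm z
    simp only [Subgroup.coe_mul, Homeomorph.mul_apply]
    by_cases h1 : m = a
    · subst h1; rw [sw_left, Equiv.swap_apply_left, hv b hb]
    · by_cases h2 : m = b
      · subst h2; rw [sw_right, Equiv.swap_apply_right, hv a ha]
      · rw [Equiv.swap_apply_of_ne_of_ne h1 h2, sw_other, hv m hm]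
        · exact fun h => sdp_dj hP hm ha h1 _ (cat_mem _ _) h
        · exact fun h => sdp_dj hP hm hb h2 _ (cat_mem _ _) h

lemma F_tab (n : ℕ) : ∀ (P : Finset (List Bool)) (w : List Bool → List Bool) (v : Vsub),
    P.card = n → IsSDP P → Tab P w v → F v = 1 := by
  induction n using Nat.strong_induction_on with
  | _ n ih =>
  intro P w v hn hP hv
  have triv : [] ∈ P → F v = 1 := by
    intro h
    have h1 : ∀ z, v.1 z = cat (w []) z := fun z => by rw [← hv [] h, cat_nil]
    have h2 : w [] = [] := by
      apply cyl_univ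
      intro x
      exact ⟨v.1.symm x, by rw [← h1]; simp⟩
    have : v = 1 := by
      apply Subtype.ext
      ext1 x
      rw [h1, h2, cat_nil]; rfl
    rw [this, map_one]
  rcases sib hP with h | ⟨u, hu0, hu1⟩
  · exact triv h
  rcases sib (sdp_image hP hv) with h | ⟨t, ht0, ht1⟩
  · obtain ⟨p, hp, hwp⟩ := Finset.mem_image.1 h
    apply triv
    have : p = [] := by
      apply cyl_univ
      intro x
      refine ⟨v.1 x, v.1.injective ?_⟩
      rw [hv p hp, hwp, cat_nil]
    rwa [this] at hp
  obtain ⟨p0, hp0, hwp0⟩ := Finset.mem_image.1 ht0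
  obtain ⟨v1, hF1, hv1⟩ := tab_swap F hP hv hu0 hp0
  set w1 : List Bool → List Bool := fun m => w (Equiv.swap (u ++ [false]) p0 m) with hw1
  have hw10 : w1 (u ++ [false]) = t ++ [false] := by simp [hw1, hwp0]
  have ht1' : ∃ p1 ∈ P, w1 p1 = t ++ [true] := by
    obtain ⟨p1, hp1, hwp1⟩ := Finset.mem_image.1 ht1
    refine ⟨Equiv.swap (u ++ [false]) p0 p1, ?_, by simp [hw1, hwp1]⟩
    rw [Equiv.swap_apply_def]
    split_ifs <;> assumption
  obtain ⟨p1, hp1, hwp1⟩ := ht1'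
  obtain ⟨v2, hF2, hv2⟩ := tab_swap F hP hv1 hu1 hp1
  have e0 : v2.1 ∘ cat (u ++ [false]) = cat (t ++ [false]) := by
    funext z
    have := hv2 _ hu0 z
    beta_reduce at this
    rw [Equiv.swap_apply_of_ne_of_ne, hw10] at this
    · exact this
    · simp
    · rintro rfl
      rw [hw10] at hwp1
      simp at hwp1
  have e1 : v2.1 ∘ cat (u ++ [true]) = cat (t ++ [true]) := by
    funext z
    have := hv2 _ hu1 z
    beta_reduce at this
    rw [Equiv.swap_apply_left, hwp1] at this
    exact this
  rw [← hF1, ← hF2]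
  refine ih _ ?_ _ (Function.update (fun m => w1 (Equiv.swap (u ++ [true]) p1 m)) u t) v2 rfl
    (sdp_merge hP hu0 hu1) ?_
  · rw [← hn]; exact card_merge hu0 hu1
  · intro m hm z
    by_cases hmu : m = u
    · subst hmu
      rw [Function.update_self]
      have hz : z = cat [z 0] (tl 1 z) := by
        funext n
        cases n <;> simp [cat, tl]
      rw [hz, ← cat_append, ← cat_append]
      cases hz0 : z 0
      · exact congrFun e0 _
      · exact congrFun e1 _
    · rw [Function.update_of_ne hmu]
      refine hv2 m ?_ z
      have := Finset.mem_of_mem_insert_of_ne hm hmu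
      exact Finset.mem_of_mem_erase (Finset.mem_of_mem_erase this)

def words (n : ℕ) : Finset (List Bool) :=
  (Finset.univ : Finset (Fin n → Bool)).image List.ofFn

lemma mem_words {n : ℕ} {m : List Bool} (h : m ∈ words n) : m.length = n := by
  obtain ⟨f, _, rfl⟩ := Finset.mem_image.1 h
  simp

lemma words_sdp (n : ℕ) : IsSDP (words n) := by
  intro x
  refine ⟨pre n x, ⟨Finset.mem_image_of_mem _ (Finset.mem_univ _), mem_cyl_pre n x⟩, ?_⟩
  rintro q ⟨hq, hx⟩
  rw [eq_pre hx, mem_words hq]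

lemma exists_tab (v : Vsub) : ∃ P w, IsSDP P ∧ Tab P w v := by
  have hv := memV_iff.1 v.2
  choose m w hm hw using hv
  obtain ⟨t, ht⟩ := isCompact_univ.elim_finite_subcover (fun x => cyl (m x))
    (fun x => isOpen_cyl _) (fun x _ => Set.mem_iUnion.2 ⟨x, hm x⟩)
  let N := t.sup (fun x => (m x).length)
  have : ∀ p : List Bool, ∃ q, p ∈ words N → ∀ z, v.1 (cat p z) = cat q z := by
    intro p
    by_cases hp : p ∈ words N
    · obtain ⟨x, hxt, hx⟩ := Set.mem_iUnion₂.1 (ht (Set.mem_univ (cat p zeroSeq)))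
      have hle : (m x).length ≤ N := Finset.le_sup (f := fun x => (m x).length) hxt
      obtain ⟨e, he⟩ := exists_append (cat_mem p zeroSeq) hx (by rw [mem_words hp]; exact hle)
      refine ⟨w x ++ e, fun _ z => ?_⟩
      rw [he, cat_append, hw, cat_append]
    · exact ⟨[], fun h => absurd h hp⟩
  choose q hq using this
  exact ⟨words N, q, words_sdp N, fun p hp z => hq p hp z⟩

theorem V_perfect (v : Vsub) : F v = 1 := by
  obtain ⟨P, w, hP, hv⟩ := exists_tab v
  exact F_tab F _ P w v rfl hP hv

end perf2

lemma word_ext_aux {w w' : List Bool} (hl : w'.length ≤ w.length)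
    (h : ∀ z, cat w z = cat w' z) : w = w' := by
  obtain ⟨e, he⟩ := exists_append (cat_mem w zeroSeq) (h zeroSeq ▸ cat_mem w' zeroSeq) hl
  have : e = [] := by
    apply cyl_univ
    intro x
    refine ⟨x, ?_⟩
    have := h x
    rw [he, cat_append] at this
    exact (cat_inj this).symm
  rw [he, this, List.append_nil]

lemma word_ext {w w' : List Bool} (h : ∀ z, cat w z = cat w' z) : w = w' := by
  rcases le_total w'.length w.length with hl | hl
  · exact word_ext_aux hl h
  · exact (word_ext_aux hl (fun z => (h z).symm)).symm

section tau
variable {Γ : Type*} [Group Γ] (α₀ α₁ : Γ ≃* Γ)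

lemma alphaWord_append (m e : List Bool) :
    alphaWord α₀ α₁ (m ++ e) = (alphaWord α₀ α₁ m).trans (alphaWord α₀ α₁ e) := by
  induction e using List.reverseRecOn with
  | nil => rw [List.append_nil]; rfl
  | append_singleton e b ih =>
    have key : ∀ l, alphaWord α₀ α₁ (l ++ [b]) =
        (alphaWord α₀ α₁ l).trans (if b then α₁ else α₀) := by
      intro l; simp [alphaWord, List.foldl_append]
    rw [← List.append_assoc, key, key, ih]; rfl

lemma tau_aux {v : Cantor ≃ₜ Cantor} {x : Cantor} {m w p q : List Bool}
    (hm : x ∈ cyl m) (hp : x ∈ cyl p) (hl : p.length ≤ m.length)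
    (h1 : ∀ z, v (cat m z) = cat w z) (h2 : ∀ z, v (cat p z) = cat q z) :
    (alphaWord α₀ α₁ m).trans (alphaWord α₀ α₁ w).symm =
      (alphaWord α₀ α₁ p).trans (alphaWord α₀ α₁ q).symm := by
  obtain ⟨e, rfl⟩ := exists_append hm hp hl
  have : w = q ++ e := word_ext (fun z => by rw [← h1, cat_append, h2, cat_append])
  rw [this, alphaWord_append, alphaWord_append]
  ext g
  simp

lemma tau_eq {v : Cantor ≃ₜ Cantor} {x : Cantor} {m w : List Bool}
    (hm : x ∈ cyl m) (h1 : ∀ z, v (cat m z) = cat w z) :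
    tauEquiv α₀ α₁ v x = (alphaWord α₀ α₁ m).trans (alphaWord α₀ α₁ w).symm := by
  have hex : ∃ p : List Bool × List Bool, x ∈ cyl p.1 ∧ ∀ z : Cantor, v (cat p.1 z) = cat p.2 z :=
    ⟨(m, w), hm, h1⟩
  unfold tauEquiv
  rw [dif_pos hex]
  have hs := hex.choose_spec
  rcases le_total m.length hex.choose.1.length with hl | hl
  · exact tau_aux α₀ α₁ hs.1 hm hl hs.2 h1
  · exact (tau_aux α₀ α₁ hm hs.1 hl h1 hs.2).symm

lemma tau_one (x : Cantor) (g : Γ) : tauEquiv α₀ α₁ 1 x g = g := by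
  rw [tau_eq α₀ α₁ (m := []) (w := []) ⟨x, (cat_nil x).symm⟩ (fun z => rfl)]
  simp

lemma tau_mul {u v : Cantor ≃ₜ Cantor} (hu : memV u) (hv : memV v) (x : Cantor) (g : Γ) :
    tauEquiv α₀ α₁ (v * u) x g = tauEquiv α₀ α₁ v (u x) (tauEquiv α₀ α₁ u x g) := by
  obtain ⟨m, w, w', hx, h1, h2⟩ := LP.comp_aux (memV_iff.1 hv) (memV_iff.1 hu) x
  have hux : u x ∈ cyl w := by
    obtain ⟨z, rfl⟩ := hx
    exact ⟨z, h1 z⟩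
  rw [tau_eq α₀ α₁ hx h1, tau_eq α₀ α₁ hux h2,
    tau_eq α₀ α₁ (v := v * u) (w := w') hx (fun z => by rw [Homeomorph.mul_apply, h1, h2])]
  simp

lemma alphaWord_fix {g : Γ} (h0 : α₀ g = g) (h1 : α₁ g = g) (m : List Bool) :
    alphaWord α₀ α₁ m g = g := by
  induction m using List.reverseRecOn with
  | nil => rfl
  | append_singleton e b ih =>
    rw [alphaWord_append, MulEquiv.trans_apply, ih]
    cases b <;> simp [alphaWord, h0, h1]

lemma tau_fix {g : Γ} (h0 : α₀ g = g) (h1 : α₁ g = g) (v : Cantor ≃ₜ Cantor) (x : Cantor) :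
    tauEquiv α₀ α₁ v x g = g := by
  unfold tauEquiv
  split_ifs with h
  · rw [MulEquiv.trans_apply, alphaWord_fix α₀ α₁ h0 h1, MulEquiv.symm_apply_eq,
      alphaWord_fix α₀ α₁ h0 h1]
  · rfl

lemma permOf_apply (a : Cantor → Γ) (v : Cantor ≃ₜ Cantor) (p : Cantor × Γ) :
    permOf α₀ α₁ a v p = (v p.1, a (v p.1) * tauEquiv α₀ α₁ v p.1 p.2) := rfl

lemma isLC_of {X : Type*} {f : Cantor → X} (N : ℕ)
    (h : ∀ w : List Bool, w.length = N → ∀ y z, f (cat w y) = f (cat w z)) : IsLC f :=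
  ⟨words N, words_sdp N, fun w hw => h w (mem_words hw)⟩

lemma isLC_one : IsLC (fun _ : Cantor => (1 : Γ)) := isLC_of 0 (fun _ _ _ _ => rfl)

lemma permOf_mem {a : Cantor → Γ} {v : Cantor ≃ₜ Cantor} (ha : IsLC a) (hv : memV v) :
    permOf α₀ α₁ a v ∈ Gsub Γ α₀ α₁ := Subgroup.subset_closure ⟨a, v, ha, hv, rfl⟩

noncomputable def gV : Vsub →* Gsub Γ α₀ α₁ :=
  MonoidHom.mk' (fun v => ⟨permOf α₀ α₁ (fun _ => 1) v.1, permOf_mem α₀ α₁ isLC_one v.2⟩) (by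
    intro v u
    apply Subtype.ext
    ext1 p
    simp only [Subgroup.coe_mul, Equiv.Perm.mul_apply, permOf_apply, Homeomorph.mul_apply, one_mul]
    rw [tau_mul α₀ α₁ u.2 v.2])

noncomputable def gL (a : Cantor → Γ) (ha : IsLC a) : Gsub Γ α₀ α₁ :=
  ⟨permOf α₀ α₁ a 1, permOf_mem α₀ α₁ ha Vsub.one_mem⟩

lemma gL_mul {a b c : Cantor → Γ} (ha : IsLC a) (hb : IsLC b) (hc : IsLC c)
    (h : ∀ x, c x = a x * b x) : gL α₀ α₁ c hc = gL α₀ α₁ a ha * gL α₀ α₁ b hb := by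
  apply Subtype.ext
  ext1 p
  simp only [Subgroup.coe_mul, Equiv.Perm.mul_apply, gL, permOf_apply, Homeomorph.one_apply,
    tau_one, h, mul_assoc]

lemma gL_conj {a b : Cantor → Γ} (ha : IsLC a) (hb : IsLC b)
    (hinv : ∀ x, α₀ (a x) = a x ∧ α₁ (a x) = a x) (v : Vsub) (h : ∀ x, b (v.1 x) = a x) :
    gV α₀ α₁ v * gL α₀ α₁ a ha = gL α₀ α₁ b hb * gV α₀ α₁ v := by
  apply Subtype.ext
  ext1 p
  simp only [Subgroup.coe_mul, Equiv.Perm.mul_apply, gL, gV, MonoidHom.mk'_apply, permOf_apply,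
    Homeomorph.one_apply, tau_one, one_mul, map_mul, h]
  rw [tau_fix α₀ α₁ (hinv _).1 (hinv _).2]

open Classical in
noncomputable def ind (g : Γ) (I : List Bool) : Cantor → Γ := fun x => if x ∈ cyl I then g else 1

lemma ind_mem {g : Γ} {I : List Bool} {x : Cantor} (h : x ∈ cyl I) : ind g I x = g := by
  simp [ind, h]

lemma ind_notMem {g : Γ} {I : List Bool} {x : Cantor} (h : x ∉ cyl I) : ind g I x = 1 := by
  simp [ind, h]

lemma isLC_ind (g : Γ) (I : List Bool) : IsLC (ind g I) := by
  refine isLC_of I.length (fun w hw y z => ?_)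
  have : cat w y ∈ cyl I ↔ cat w z ∈ cyl I := by
    rw [mem_cyl_iff, mem_cyl_iff]
    refine forall₂_congr (fun i hi => ?_)
    rw [cat_lt _ _ (by omega), cat_lt _ _ (by omega)]
  by_cases h : cat w z ∈ cyl I
  · rw [ind_mem h, ind_mem (this.2 h)]
  · rw [ind_notMem h, ind_notMem (fun h' => h (this.1 h'))]

variable {A : Type*} [CommGroup A] (ψ : Gsub Γ α₀ α₁ →* A)

lemma psi_V (v : Vsub) : ψ (gV α₀ α₁ v) = 1 := V_perfect (ψ.comp (gV α₀ α₁)) v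

lemma psi_ind_eq {g : Γ} (h0 : α₀ g = g) (h1 : α₁ g = g) {I J : List Bool} (h : Dj I J) :
    ψ (gL α₀ α₁ (ind g I) (isLC_ind g I)) = ψ (gL α₀ α₁ (ind g J) (isLC_ind g J)) := by
  have := congrArg ψ (gL_conj α₀ α₁ (isLC_ind g I) (isLC_ind g J) (fun x => by
    by_cases hx : x ∈ cyl I
    · rw [ind_mem hx]; exact ⟨h0, h1⟩
    · rw [ind_notMem hx]; simp) (sw I J h) (fun x => by
    by_cases hx : x ∈ cyl I
    · rw [ind_mem hx]
      obtain ⟨z, rfl⟩ := hx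
      rw [sw_left, ind_mem (cat_mem _ _)]
    · rw [ind_notMem hx]
      by_cases hx' : x ∈ cyl J
      · obtain ⟨z, rfl⟩ := hx'
        rw [sw_right, ind_notMem (fun h' => h _ (cat_mem _ _) h')]
      · rw [sw_other h hx hx', ind_notMem hx']))
  rw [map_mul, map_mul, mul_comm] at this
  exact mul_right_cancel this

lemma ind_split (g : Γ) (I : List Bool) (x : Cantor) :
    ind g I x = ind g (I ++ [false]) x * ind g (I ++ [true]) x := by
  by_cases hx : x ∈ cyl I
  · rw [ind_mem hx]
    rcases mem_split hx with h | h
    · rw [ind_mem h, ind_notMem (fun h' => Dj_sib I _ h h'), mul_one]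
    · rw [ind_mem h, ind_notMem (fun h' => Dj_sib I _ h' h), one_mul]
  · rw [ind_notMem hx, ind_notMem (fun h => hx (cyl_append_sub h)),
      ind_notMem (fun h => hx (cyl_append_sub h)), one_mul]

lemma psi_ind_split (g : Γ) (I : List Bool) :
    ψ (gL α₀ α₁ (ind g I) (isLC_ind g I)) =
      ψ (gL α₀ α₁ (ind g (I ++ [false])) (isLC_ind g _)) *
      ψ (gL α₀ α₁ (ind g (I ++ [true])) (isLC_ind g _)) := by
  rw [← map_mul, gL_mul α₀ α₁ _ _ (isLC_ind g I) (ind_split g I)]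

lemma psi_ind2 {g : Γ} (h0 : α₀ g = g) (h1 : α₁ g = g) {I J : List Bool} (h : Dj I J) :
    ψ (gL α₀ α₁ (ind g I) (isLC_ind g I)) = 1 := by
  have key : ∀ e, ψ (gL α₀ α₁ (ind g (I ++ e)) (isLC_ind g _)) =
      ψ (gL α₀ α₁ (ind g I) (isLC_ind g I)) := by
    intro e
    rw [psi_ind_eq α₀ α₁ ψ h0 h1 (h.appl e), psi_ind_eq α₀ α₁ ψ h0 h1 h]
  have := psi_ind_split α₀ α₁ ψ g I
  rw [key, key] at this
  exact left_eq_mul.1 this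

lemma psi_ind {g : Γ} (h0 : α₀ g = g) (h1 : α₁ g = g) (I : List Bool) :
    ψ (gL α₀ α₁ (ind g I) (isLC_ind g I)) = 1 := by
  rw [psi_ind_split, psi_ind2 α₀ α₁ ψ h0 h1 (Dj_sib I), psi_ind2 α₀ α₁ ψ h0 h1 (Dj_sib I).symm,
    one_mul]

lemma psi_gL {a : Cantor → Γ} (ha : IsLC a)
    (hinv : ∀ x, α₀ (a x) = a x ∧ α₁ (a x) = a x) : ψ (gL α₀ α₁ a ha) = 1 := by
  classical
  obtain ⟨P, hP, hc⟩ := id ha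
  have main : ∀ S : Finset (List Bool), S ⊆ P → ∀ b : Cantor → Γ, ∀ hb : IsLC b,
      (∀ x, b x = if ∃ w ∈ S, x ∈ cyl w then a x else 1) → ψ (gL α₀ α₁ b hb) = 1 := by
    intro S
    induction S using Finset.induction_on with
    | empty =>
      intro _ b hb h
      have : gL α₀ α₁ b hb = gL α₀ α₁ b hb * gL α₀ α₁ b hb :=
        gL_mul α₀ α₁ hb hb hb (fun x => by simp [h])
      rw [left_eq_mul.1 this, map_one]
    | insert w S hw ih =>
      intro hS b hb h
      have hwP : w ∈ P := hS (Finset.mem_insert_self _ _)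
      have hSP : S ⊆ P := fun s hs => hS (Finset.mem_insert_of_mem hs)
      have hb' : IsLC (fun x => if ∃ w ∈ S, x ∈ cyl w then a x else 1) := by
        refine ⟨P, hP, fun p hp y z => ?_⟩
        have : ∀ t, (∃ w ∈ S, cat p t ∈ cyl w) ↔ p ∈ S := by
          intro t
          constructor
          · rintro ⟨q, hq, hx⟩
            rwa [(hP _).unique ⟨hp, cat_mem p t⟩ ⟨hSP hq, hx⟩]
          · intro h; exact ⟨p, h, cat_mem _ _⟩
        simp only [this, hc p hp y z]
      have e := gL_mul α₀ α₁ (isLC_ind (a (cat w zeroSeq)) w) hb' hb (fun x => by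
        rw [h]
        by_cases hx : x ∈ cyl w
        · have hn : ¬ ∃ w ∈ S, x ∈ cyl w := by
            rintro ⟨q, hq, hxq⟩
            rw [(hP x).unique ⟨hSP hq, hxq⟩ ⟨hwP, hx⟩] at hq
            exact hw hq
          rw [ind_mem hx, if_neg hn, if_pos ⟨w, Finset.mem_insert_self _ _, hx⟩, mul_one]
          obtain ⟨z, rfl⟩ := hx
          exact hc w hwP _ _
        · rw [ind_notMem hx, one_mul]
          simp [hx])
      rw [e, map_mul, psi_ind α₀ α₁ ψ (hinv _).1 (hinv _).2, one_mul]
      exact ih hSP _ hb' (fun x => rfl)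
  refine main P subset_rfl a ha (fun x => ?_)
  obtain ⟨w, hw, _⟩ := hP x
  rw [if_pos ⟨w, hw⟩]

theorem psi_kill {a : Cantor → Γ} (ha : IsLC a)
    (hinv : ∀ x, α₀ (a x) = a x ∧ α₁ (a x) = a x) {v : Cantor ≃ₜ Cantor} (hv : memV v)
    (h : permOf α₀ α₁ a v ∈ Gsub Γ α₀ α₁) : ψ ⟨permOf α₀ α₁ a v, h⟩ = 1 := by
  have : (⟨permOf α₀ α₁ a v, h⟩ : Gsub Γ α₀ α₁) = gL α₀ α₁ a ha * gV α₀ α₁ ⟨v, hv⟩ := by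
    apply Subtype.ext
    ext1 p
    simp only [Subgroup.coe_mul, Equiv.Perm.mul_apply, gL, gV, MonoidHom.mk'_apply, permOf_apply,
      Homeomorph.one_apply, tau_one, one_mul]
  rw [this, map_mul, psi_gL α₀ α₁ ψ ha hinv, psi_V, one_mul]

end tau

end TV

/-- For the twisted fraction group `G = LΓ ⋊ V` of `(Γ, α₀, α₁)`, the
subgroup `L(Γ^α) ⋊ V` lies in the derived subgroup `[G,G]`; consequently every morphism
from `G` to an abelian group kills `L(Γ^α) ⋊ V`. -/
theorem subgroup_in_derived (Γ : Type*) [Group Γ] (α₀ α₁ : Γ ≃* Γ)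
    (a : Cantor → Γ) (ha : IsLC a)
    (hinv : ∀ x, α₀ (a x) = a x ∧ α₁ (a x) = a x)
    (v : Cantor ≃ₜ Cantor) (hv : memV v) :
    permOf α₀ α₁ a v ∈ ⁅Gsub Γ α₀ α₁, Gsub Γ α₀ α₁⁆ ∧
    ∀ (A : Type) (_ : CommGroup A) (ψ : ↥(Gsub Γ α₀ α₁) →* A)
      (h : permOf α₀ α₁ a v ∈ Gsub Γ α₀ α₁),
      ψ ⟨permOf α₀ α₁ a v, h⟩ = 1 := by
  refine ⟨?_, fun A _ ψ h => TV.psi_kill α₀ α₁ ψ ha hinv hv h⟩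
  have hmem := TV.permOf_mem α₀ α₁ ha hv
  have h1 := TV.psi_kill α₀ α₁ (Abelianization.of (G := Gsub Γ α₀ α₁)) ha hinv hv hmem
  have h2 : (⟨permOf α₀ α₁ a v, hmem⟩ : Gsub Γ α₀ α₁) ∈ commutator (Gsub Γ α₀ α₁) := by
    rw [← Abelianization.ker_of]
    exact h1
  rw [← Subgroup.map_subtype_commutator]
  exact ⟨_, h2, rfl⟩
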